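/- arXiv:math/0404246 — 2 statements merged into one kernel-verified Lean document; each statement's English description precedes it below -/
import Mathlib

section
/- For every integer κ ≥ 4, the κ-th prolongation coefficient R^κ (defined recursively by R^λ = D(R^{λ-1}) - D(Q)U^λ with R¹ = D(R) - D(Q)U¹, for n=m=1) has the following coefficients as a polynomial in the jet variables U¹,…,U^κ: the coefficient of the constant monomial is R_{x^κ}; the coefficient of U¹ is C(κ,1)R_{x^{κ-1}u} - Q_{x^κ}; the coefficient of U^{κ-1} is C(κ,1)R_{xu} - C(κ,2)Q_{x²}; the coefficient of U¹U^{κ-1} is C(κ,1)R_{u²} - κ²Q_{xu}; the coefficient of U²U^{κ-1} is -C(κ+1,2)Q_u; the coefficient of U^κ is R_u - C(κ,1)Q_x; and the coefficient of U¹U^κ is -C(κ+1,1)Q_u. -/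
/-- The total derivative operator `D` on functions of `(x, u, U¹, U², …)`
(`U (l)` stands for the jet variable `U^{l+1}`):
`D P = P_x + U¹ P_u + ∑_λ U^{λ+1} P_{U^λ}`. -/
noncomputable def totalD (P : ℝ → ℝ → (ℕ → ℝ) → ℝ) : ℝ → ℝ → (ℕ → ℝ) → ℝ :=
  fun x u U =>
    deriv (fun s => P s u U) x + U 0 * deriv (fun t => P x t U) u
      + ∑' l : ℕ, U (l + 1) * deriv (fun t => P x u (Function.update U l t)) (U l)

/-- The prolongation coefficients: `R⁰ = R`, `R^{λ+1} = D(R^λ) - D(Q)·U^{λ+1}`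
(so `R¹ = D(R) - D(Q)U¹`). -/
noncomputable def prolong (Q R : ℝ → ℝ → ℝ) : ℕ → ℝ → ℝ → (ℕ → ℝ) → ℝ
  | 0 => fun x u _ => R x u
  | (l + 1) => fun x u U =>
      totalD (prolong Q R l) x u U - totalD (fun s t _ => Q s t) x u U * U l

/-- partial derivative with respect to `x`. -/
noncomputable def px (f : ℝ → ℝ → ℝ) : ℝ → ℝ → ℝ := fun x u => deriv (fun s => f s u) x

/-- partial derivative with respect to `u`. -/
noncomputable def pu (f : ℝ → ℝ → ℝ) : ℝ → ℝ → ℝ := fun x u => deriv (fun t => f x t) u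

/-- partial derivative with respect to the jet variable `U^{i+1}`. -/
noncomputable def pU (i : ℕ) (F : ℝ → ℝ → (ℕ → ℝ) → ℝ) : ℝ → ℝ → (ℕ → ℝ) → ℝ :=
  fun x u U => deriv (fun t => F x u (Function.update U i t)) (U i)

/-- Functions on the jet space; the third argument lists the jet variables. -/
abbrev JetFun : Type := ℝ → ℝ → (ℕ → ℝ) → ℝ

/-- Smoothness of a function of `(x, u)`. -/
def Smooth₂ (f : ℝ → ℝ → ℝ) : Prop :=
  ContDiff ℝ (⊤ : ℕ∞) (fun p : ℝ × ℝ => f p.1 p.2)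

namespace Smooth₂

variable {f g : ℝ → ℝ → ℝ}

theorem const (c : ℝ) : Smooth₂ (fun _ _ => c) := contDiff_const

theorem px_eq_fderiv (hf : Smooth₂ f) (x u : ℝ) :
    px f x u = fderiv ℝ (fun p : ℝ × ℝ => f p.1 p.2) (x, u) (1, 0) := by
  have h : HasFDerivAt (fun p : ℝ × ℝ => f p.1 p.2) _ (x, u) :=
    (hf.differentiable (by simp) (x, u)).hasFDerivAt
  exact (h.comp_hasDerivAt x ((hasDerivAt_id x).prodMk (hasDerivAt_const x u))).deriv

theorem pu_eq_fderiv (hf : Smooth₂ f) (x u : ℝ) :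
    pu f x u = fderiv ℝ (fun p : ℝ × ℝ => f p.1 p.2) (x, u) (0, 1) := by
  have h : HasFDerivAt (fun p : ℝ × ℝ => f p.1 p.2) _ (x, u) :=
    (hf.differentiable (by simp) (x, u)).hasFDerivAt
  exact (h.comp_hasDerivAt u ((hasDerivAt_const u x).prodMk (hasDerivAt_id u))).deriv

theorem px (hf : Smooth₂ f) : Smooth₂ (px f) := by
  have h : ContDiff ℝ (⊤ : ℕ∞) (fderiv ℝ (fun p : ℝ × ℝ => f p.1 p.2)) :=
    hf.fderiv_right (by simp)
  unfold Smooth₂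
  simp_rw [hf.px_eq_fderiv]
  exact h.clm_apply contDiff_const

theorem pu (hf : Smooth₂ f) : Smooth₂ (pu f) := by
  have h : ContDiff ℝ (⊤ : ℕ∞) (fderiv ℝ (fun p : ℝ × ℝ => f p.1 p.2)) :=
    hf.fderiv_right (by simp)
  unfold Smooth₂
  simp_rw [hf.pu_eq_fderiv]
  exact h.clm_apply contDiff_const

theorem iterate_px (hf : Smooth₂ f) (k : ℕ) : Smooth₂ (_root_.px^[k] f) := by
  induction k with
  | zero => exact hf
  | succ k ih => rw [Function.iterate_succ_apply']; exact ih.px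

theorem px_pu (hf : Smooth₂ f) : _root_.px (_root_.pu f) = _root_.pu (_root_.px f) := by
  funext x u
  have hd : DifferentiableAt ℝ (fderiv ℝ (fun p : ℝ × ℝ => f p.1 p.2)) (x, u) :=
    (ContDiff.fderiv_right (m := (⊤ : ℕ∞)) hf (by simp)).differentiable (by simp) _
  have hsymm : IsSymmSndFDerivAt ℝ (fun p : ℝ × ℝ => f p.1 p.2) (x, u) :=
    (ContDiff.contDiffAt hf).isSymmSndFDerivAt <| by
      rw [minSmoothness_of_isRCLikeNormedField]
      exact WithTop.coe_le_coe.2 (le_top : (2 : ℕ∞) ≤ ⊤)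
  rw [hf.pu.px_eq_fderiv, hf.px.pu_eq_fderiv]
  simp_rw [hf.pu_eq_fderiv, hf.px_eq_fderiv]
  rw [fderiv_clm_apply hd (by fun_prop), fderiv_clm_apply hd (by fun_prop)]
  simpa using hsymm (1, 0) (0, 1)

theorem differentiable_left (hf : Smooth₂ f) (u : ℝ) : Differentiable ℝ (fun s => f s u) :=
  (hf.differentiable (by simp)).comp (by fun_prop : Differentiable ℝ fun s : ℝ => (s, u))

theorem differentiable_right (hf : Smooth₂ f) (x : ℝ) : Differentiable ℝ (fun t => f x t) :=
  (hf.differentiable (by simp)).comp (by fun_prop : Differentiable ℝ fun t : ℝ => (x, t))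

theorem px_linear (hf : Smooth₂ f) (hg : Smooth₂ g) (a b : ℝ) :
    _root_.px (fun x u => a * f x u - b * g x u) =
      fun x u => a * _root_.px f x u - b * _root_.px g x u := by
  funext x u
  exact (((hf.differentiable_left u x).hasDerivAt.const_mul a).sub
    ((hg.differentiable_left u x).hasDerivAt.const_mul b)).deriv

theorem pu_linear (hf : Smooth₂ f) (hg : Smooth₂ g) (a b : ℝ) :
    _root_.pu (fun x u => a * f x u - b * g x u) =
      fun x u => a * _root_.pu f x u - b * _root_.pu g x u := by
  funext x u
  exact (((hf.differentiable_right x u).hasDerivAt.const_mul a).sub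
    ((hg.differentiable_right x u).hasDerivAt.const_mul b)).deriv

end Smooth₂

/-- A function of `(x, u)`, seen on the jet space. -/
def JetFun.base (f : ℝ → ℝ → ℝ) : JetFun := fun x u _ => f x u

/-- The jet coordinate `U i`. -/
def JetFun.coord (i : ℕ) : JetFun := fun _ _ U => U i

/-- The partial derivative with respect to `x` on the jet space. -/
noncomputable def JetFun.dx (P : JetFun) : JetFun := fun x u U => deriv (fun s => P s u U) x

/-- The partial derivative with respect to `u` on the jet space. -/
noncomputable def JetFun.du (P : JetFun) : JetFun := fun x u U => deriv (fun t => P x t U) u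

/-- The restriction of a jet function to the zero section `U = 0`. -/
def JetFun.atZero (P : JetFun) : ℝ → ℝ → ℝ := fun x u => P x u (fun _ => 0)

open JetFun

/-- Polynomials in the jet variables with smooth functions of `(x, u)` as coefficients. -/
inductive IsJetPoly : JetFun → Prop
  | base {f : ℝ → ℝ → ℝ} (hf : Smooth₂ f) : IsJetPoly (base f)
  | coord (i : ℕ) : IsJetPoly (coord i)
  | add {P S : JetFun} : IsJetPoly P → IsJetPoly S → IsJetPoly (P + S)
  | mul {P S : JetFun} : IsJetPoly P → IsJetPoly S → IsJetPoly (P * S)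

/-- The operator `δ` is a derivation of the ring of jet polynomials. -/
structure IsJetDerivation (δ : JetFun → JetFun) : Prop where
  map_base {f : ℝ → ℝ → ℝ} : Smooth₂ f → IsJetPoly (δ (base f))
  map_coord (i : ℕ) : IsJetPoly (δ (coord i))
  add {P S : JetFun} : IsJetPoly P → IsJetPoly S → δ (P + S) = δ P + δ S
  mul {P S : JetFun} : IsJetPoly P → IsJetPoly S → δ (P * S) = δ P * S + P * δ S

namespace IsJetPoly

variable {P S : JetFun}

theorem zero : IsJetPoly 0 := base (Smooth₂.const 0)

theorem one : IsJetPoly 1 := base (Smooth₂.const 1)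

theorem neg (hP : IsJetPoly P) : IsJetPoly (-P) := by
  have h := (base (Smooth₂.const (-1))).mul hP
  rwa [show JetFun.base (fun _ _ => -1) * P = -P by funext x u U; simp [JetFun.base]] at h

theorem sub (hP : IsJetPoly P) (hS : IsJetPoly S) : IsJetPoly (P - S) := by
  rw [sub_eq_add_neg]; exact hP.add hS.neg

theorem differentiable_x (hP : IsJetPoly P) (u : ℝ) (U : ℕ → ℝ) :
    Differentiable ℝ (fun s => P s u U) := by
  induction hP with
  | base hf => exact hf.differentiable_left u
  | coord i => exact differentiable_const _
  | add _ _ h₁ h₂ => exact h₁.add h₂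
  | mul _ _ h₁ h₂ => exact h₁.mul h₂

theorem differentiable_u (hP : IsJetPoly P) (x : ℝ) (U : ℕ → ℝ) :
    Differentiable ℝ (fun t => P x t U) := by
  induction hP with
  | base hf => exact hf.differentiable_right x
  | coord i => exact differentiable_const _
  | add _ _ h₁ h₂ => exact h₁.add h₂
  | mul _ _ h₁ h₂ => exact h₁.mul h₂

theorem differentiable_update (hP : IsJetPoly P) (i : ℕ) (x u : ℝ) (U : ℕ → ℝ) :
    Differentiable ℝ (fun t => P x u (Function.update U i t)) := by
  induction hP with
  | base hf => exact differentiable_const _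
  | coord j =>
    by_cases h : j = i
    · subst h; simp [JetFun.coord]
    · simp [JetFun.coord, Function.update_of_ne h]
  | add _ _ h₁ h₂ => exact h₁.add h₂
  | mul _ _ h₁ h₂ => exact h₁.mul h₂

theorem map (hP : IsJetPoly P) {δ : JetFun → JetFun} (hδ : IsJetDerivation δ) :
    IsJetPoly (δ P) := by
  induction hP with
  | base hf => exact hδ.map_base hf
  | coord i => exact hδ.map_coord i
  | add h₁ h₂ ih₁ ih₂ => rw [hδ.add h₁ h₂]; exact ih₁.add ih₂
  | mul h₁ h₂ ih₁ ih₂ => rw [hδ.mul h₁ h₂]; exact (ih₁.mul h₂).add (h₁.mul ih₂)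

end IsJetPoly

theorem dx_base (f : ℝ → ℝ → ℝ) : dx (base f) = base (px f) := rfl

theorem du_base (f : ℝ → ℝ → ℝ) : du (base f) = base (pu f) := rfl

theorem dx_coord (i : ℕ) : dx (coord i) = 0 := by
  funext x u U; simp [dx, coord]

theorem du_coord (i : ℕ) : du (coord i) = 0 := by
  funext x u U; simp [du, coord]

theorem pU_base (i : ℕ) (f : ℝ → ℝ → ℝ) : pU i (base f) = 0 := by
  funext x u U; simp [pU, base]

theorem pU_coord (i j : ℕ) : pU i (coord j) = if i = j then 1 else 0 := by
  funext x u U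
  by_cases h : i = j
  · subst h; simp [pU, coord]
  · simp [pU, coord, Function.update_of_ne (Ne.symm h), h]

theorem isJetDerivation_dx : IsJetDerivation dx where
  map_base hf := .base hf.px
  map_coord i := by rw [dx_coord]; exact .zero
  add hP hS := by
    funext x u U
    exact ((hP.differentiable_x u U x).hasDerivAt.add (hS.differentiable_x u U x).hasDerivAt).deriv
  mul hP hS := by
    funext x u U
    exact ((hP.differentiable_x u U x).hasDerivAt.mul (hS.differentiable_x u U x).hasDerivAt).deriv

theorem isJetDerivation_du : IsJetDerivation du where
  map_base hf := .base hf.pu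
  map_coord i := by rw [du_coord]; exact .zero
  add hP hS := by
    funext x u U
    exact ((hP.differentiable_u x U u).hasDerivAt.add (hS.differentiable_u x U u).hasDerivAt).deriv
  mul hP hS := by
    funext x u U
    exact ((hP.differentiable_u x U u).hasDerivAt.mul (hS.differentiable_u x U u).hasDerivAt).deriv

theorem isJetDerivation_pU (i : ℕ) : IsJetDerivation (pU i) where
  map_base hf := by rw [pU_base]; exact .zero
  map_coord j := by
    rw [pU_coord]
    split_ifs
    · exact .one
    · exact .zero
  add hP hS := by
    funext x u U
    exact ((hP.differentiable_update i x u U (U i)).hasDerivAt.add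
      (hS.differentiable_update i x u U (U i)).hasDerivAt).deriv
  mul {P S} hP hS := by
    funext x u U
    have h := ((hP.differentiable_update i x u U (U i)).hasDerivAt.mul
      (hS.differentiable_update i x u U (U i)).hasDerivAt).deriv
    simp only [Function.update_eq_self] at h
    exact h

theorem isJetDerivation_zero : IsJetDerivation (fun _ => 0) where
  map_base _ := .zero
  map_coord _ := .zero
  add _ _ := by simp
  mul _ _ := by simp

theorem IsJetDerivation.map_sub {δ : JetFun → JetFun} (hδ : IsJetDerivation δ) {P S : JetFun}
    (hP : IsJetPoly P) (hS : IsJetPoly S) : δ (P - S) = δ P - δ S := by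
  rw [eq_sub_iff_add_eq, ← hδ.add (hP.sub hS) hS, sub_add_cancel]

theorem IsJetPoly.exists_pU_eq_zero {P : JetFun} (hP : IsJetPoly P) :
    ∃ n, ∀ l, n ≤ l → pU l P = 0 := by
  induction hP with
  | base hf => exact ⟨0, fun l _ => pU_base l _⟩
  | coord i => exact ⟨i + 1, fun l hl => by rw [pU_coord, if_neg (by omega)]⟩
  | add h₁ h₂ ih₁ ih₂ =>
    obtain ⟨n, hn⟩ := ih₁
    obtain ⟨m, hm⟩ := ih₂
    refine ⟨max n m, fun l hl => ?_⟩
    rw [(isJetDerivation_pU l).add h₁ h₂, hn l (le_of_max_le_left hl),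
      hm l (le_of_max_le_right hl), add_zero]
  | mul h₁ h₂ ih₁ ih₂ =>
    obtain ⟨n, hn⟩ := ih₁
    obtain ⟨m, hm⟩ := ih₂
    refine ⟨max n m, fun l hl => ?_⟩
    rw [(isJetDerivation_pU l).mul h₁ h₂, hn l (le_of_max_le_left hl),
      hm l (le_of_max_le_right hl), zero_mul, mul_zero, add_zero]

theorem totalD_eq_sum {P : JetFun} {n : ℕ} (hn : ∀ l, n ≤ l → pU l P = 0) :
    totalD P = dx P + coord 0 * du P + ∑ l ∈ Finset.range n, coord (l + 1) * pU l P := by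
  funext x u U
  have h : ∑' l : ℕ, U (l + 1) * pU l P x u U =
      ∑ l ∈ Finset.range n, U (l + 1) * pU l P x u U :=
    tsum_eq_sum fun l hl => by
      rw [hn l (by simpa using hl)]; simp
  simp only [Pi.add_apply, Pi.mul_apply, Finset.sum_apply]
  exact congrArg (deriv (fun s => P s u U) x + U 0 * deriv (fun t => P x t U) u + ·) h

theorem totalD_base (f : ℝ → ℝ → ℝ) :
    totalD (base f) = base (px f) + coord 0 * base (pu f) := by
  rw [totalD_eq_sum (n := 0) fun l _ => pU_base l f]
  simp [dx_base, du_base]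

theorem totalD_coord (i : ℕ) : totalD (coord i) = coord (i + 1) := by
  rw [totalD_eq_sum (n := i + 1) fun l hl => by rw [pU_coord, if_neg (by omega)]]
  simp [dx_coord, du_coord, pU_coord]

theorem totalD_zero : totalD 0 = 0 := by
  funext x u U; simp [totalD]

theorem totalD_one : totalD 1 = 0 := by
  funext x u U; simp [totalD]

theorem isJetDerivation_totalD : IsJetDerivation totalD where
  map_base hf := by
    rw [totalD_base]; exact (IsJetPoly.base hf.px).add ((IsJetPoly.coord 0).mul (.base hf.pu))
  map_coord i := by rw [totalD_coord]; exact .coord _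
  add {P S} hP hS := by
    obtain ⟨n, hn⟩ := hP.exists_pU_eq_zero
    obtain ⟨m, hm⟩ := hS.exists_pU_eq_zero
    have hn' : ∀ l, max n m ≤ l → pU l P = 0 := fun l hl => hn l (le_of_max_le_left hl)
    have hm' : ∀ l, max n m ≤ l → pU l S = 0 := fun l hl => hm l (le_of_max_le_right hl)
    have hadd (l : ℕ) : pU l (P + S) = pU l P + pU l S := (isJetDerivation_pU l).add hP hS
    rw [totalD_eq_sum hn', totalD_eq_sum hm',
      totalD_eq_sum (n := max n m) fun l hl => by rw [hadd, hn' l hl, hm' l hl, add_zero],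
      isJetDerivation_dx.add hP hS, isJetDerivation_du.add hP hS]
    simp_rw [hadd, mul_add, Finset.sum_add_distrib]
    ring
  mul {P S} hP hS := by
    obtain ⟨n, hn⟩ := hP.exists_pU_eq_zero
    obtain ⟨m, hm⟩ := hS.exists_pU_eq_zero
    have hn' : ∀ l, max n m ≤ l → pU l P = 0 := fun l hl => hn l (le_of_max_le_left hl)
    have hm' : ∀ l, max n m ≤ l → pU l S = 0 := fun l hl => hm l (le_of_max_le_right hl)
    have hmul (l : ℕ) : pU l (P * S) = pU l P * S + P * pU l S := (isJetDerivation_pU l).mul hP hS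
    rw [totalD_eq_sum hn', totalD_eq_sum hm',
      totalD_eq_sum (n := max n m) fun l hl => by
        rw [hmul, hn' l hl, hm' l hl, zero_mul, mul_zero, add_zero],
      isJetDerivation_dx.mul hP hS, isJetDerivation_du.mul hP hS]
    have hsum : ∑ l ∈ Finset.range (max n m), coord (l + 1) * pU l (P * S) =
        (∑ l ∈ Finset.range (max n m), coord (l + 1) * pU l P) * S +
          P * ∑ l ∈ Finset.range (max n m), coord (l + 1) * pU l S := by
      rw [Finset.sum_mul, Finset.mul_sum, ← Finset.sum_add_distrib]
      exact Finset.sum_congr rfl fun l _ => by rw [hmul]; ring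
    rw [hsum]
    ring

/-- A commutation relation between derivations holds once it holds on the generators. -/
theorem IsJetPoly.commutator_eq {δ ε μ : JetFun → JetFun} (hδ : IsJetDerivation δ)
    (hε : IsJetDerivation ε) (hμ : IsJetDerivation μ)
    (hbase : ∀ f, Smooth₂ f → δ (ε (JetFun.base f)) = ε (δ (JetFun.base f)) + μ (JetFun.base f))
    (hcoord : ∀ i, δ (ε (JetFun.coord i)) = ε (δ (JetFun.coord i)) + μ (JetFun.coord i))
    {P : JetFun} (hP : IsJetPoly P) : δ (ε P) = ε (δ P) + μ P := by
  induction hP with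
  | base hf => exact hbase _ hf
  | coord i => exact hcoord i
  | add h₁ h₂ ih₁ ih₂ =>
    rw [hε.add h₁ h₂, hδ.add h₁ h₂, hμ.add h₁ h₂, hδ.add (h₁.map hε) (h₂.map hε),
      hε.add (h₁.map hδ) (h₂.map hδ), ih₁, ih₂]
    ring
  | mul h₁ h₂ ih₁ ih₂ =>
    rw [hε.mul h₁ h₂, hδ.mul h₁ h₂, hμ.mul h₁ h₂,
      hδ.add ((h₁.map hε).mul h₂) (h₁.mul (h₂.map hε)),
      hε.add ((h₁.map hδ).mul h₂) (h₁.mul (h₂.map hδ)),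
      hδ.mul (h₁.map hε) h₂, hδ.mul h₁ (h₂.map hε),
      hε.mul (h₁.map hδ) h₂, hε.mul h₁ (h₂.map hδ), ih₁, ih₂]
    ring

theorem IsJetPoly.pU_zero_totalD {P : JetFun} (hP : IsJetPoly P) :
    pU 0 (totalD P) = totalD (pU 0 P) + du P := by
  refine hP.commutator_eq (isJetDerivation_pU 0) isJetDerivation_totalD isJetDerivation_du
    (fun f hf => ?_) fun i => ?_
  · rw [totalD_base, (isJetDerivation_pU 0).add (.base hf.px) ((IsJetPoly.coord 0).mul (.base hf.pu)),
      (isJetDerivation_pU 0).mul (.coord 0) (.base hf.pu)]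
    simp [pU_base, pU_coord, totalD_zero, du_base]
  · rw [totalD_coord, pU_coord, pU_coord, du_coord]
    split_ifs <;> simp_all [totalD_zero, totalD_one]

theorem IsJetPoly.pU_succ_totalD {P : JetFun} (hP : IsJetPoly P) (i : ℕ) :
    pU (i + 1) (totalD P) = totalD (pU (i + 1) P) + pU i P := by
  refine hP.commutator_eq (isJetDerivation_pU (i + 1)) isJetDerivation_totalD
    (isJetDerivation_pU i) (fun f hf => ?_) fun j => ?_
  · rw [totalD_base, (isJetDerivation_pU _).add (.base hf.px) ((IsJetPoly.coord 0).mul (.base hf.pu)),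
      (isJetDerivation_pU _).mul (.coord 0) (.base hf.pu)]
    simp [pU_base, pU_coord, totalD_zero]
  · rw [totalD_coord, pU_coord, pU_coord, pU_coord]
    split_ifs <;> simp_all [totalD_zero, totalD_one]

theorem IsJetPoly.pU_du {P : JetFun} (hP : IsJetPoly P) (i : ℕ) :
    pU i (du P) = du (pU i P) := by
  have hzero : du 0 = 0 := by funext x u U; simp [du]
  have hone : du 1 = 0 := by funext x u U; simp [du]
  have hpU : pU i 0 = 0 := by funext x u U; simp [pU]
  have h := hP.commutator_eq (isJetDerivation_pU i) isJetDerivation_du isJetDerivation_zero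
    (fun f hf => by simp [du_base, pU_base, hzero])
    (fun j => by
      rw [du_coord, pU_coord, hpU]
      split_ifs <;> simp [hzero, hone])
  simpa using h

theorem atZero_totalD (P : JetFun) : atZero (totalD P) = px (atZero P) := by
  funext x u; simp [atZero, totalD, px]

theorem atZero_du (P : JetFun) : atZero (du P) = pu (atZero P) := rfl

theorem pU_zero_totalD_base {f : ℝ → ℝ → ℝ} (hf : Smooth₂ f) :
    pU 0 (totalD (base f)) = base (pu f) := by
  rw [(IsJetPoly.base hf).pU_zero_totalD, pU_base, totalD_zero, zero_add, du_base]

theorem pU_succ_totalD_base {f : ℝ → ℝ → ℝ} (hf : Smooth₂ f) (i : ℕ) :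
    pU (i + 1) (totalD (base f)) = 0 := by
  rw [(IsJetPoly.base hf).pU_succ_totalD, pU_base, totalD_zero, zero_add, pU_base]

theorem pU_pU_coord (i j k : ℕ) : pU i (pU j (coord k)) = 0 := by
  rw [pU_coord]
  funext x u U
  split_ifs <;> simp [pU]

theorem atZero_add (P S : JetFun) : atZero (P + S) = atZero P + atZero S := rfl

theorem atZero_sub (P S : JetFun) : atZero (P - S) = atZero P - atZero S := rfl

theorem atZero_mul (P S : JetFun) : atZero (P * S) = atZero P * atZero S := rfl

theorem atZero_base (f : ℝ → ℝ → ℝ) : atZero (base f) = f := rfl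

theorem atZero_coord (i : ℕ) : atZero (coord i) = 0 := rfl

theorem atZero_pU_coord (i j : ℕ) : atZero (pU i (coord j)) = if i = j then 1 else 0 := by
  rw [pU_coord]
  split_ifs <;> rfl

theorem atZero_zero : atZero 0 = 0 := rfl

theorem px_zero : px 0 = 0 := by funext x u; simp [px]

theorem pu_zero : pu 0 = 0 := by funext x u; simp [pu]

theorem prolong_succ (Q R : ℝ → ℝ → ℝ) (k : ℕ) :
    prolong Q R (k + 1) = totalD (prolong Q R k) - totalD (base Q) * coord k := rfl

section Prolong

variable {Q R : ℝ → ℝ → ℝ}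

theorem isJetPoly_prolong (hQ : Smooth₂ Q) (hR : Smooth₂ R) (k : ℕ) :
    IsJetPoly (prolong Q R k) := by
  induction k with
  | zero => exact .base hR
  | succ k ih =>
    exact (ih.map isJetDerivation_totalD).sub
      (((IsJetPoly.base hQ).map isJetDerivation_totalD).mul (.coord k))

theorem pU_prolong_succ (hQ : Smooth₂ Q) (hR : Smooth₂ R) (i k : ℕ) :
    pU i (prolong Q R (k + 1)) = pU i (totalD (prolong Q R k)) -
      (pU i (totalD (base Q)) * coord k + totalD (base Q) * pU i (coord k)) := by
  have hT := (IsJetPoly.base hQ).map isJetDerivation_totalD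
  rw [prolong_succ, (isJetDerivation_pU i).map_sub
    ((isJetPoly_prolong hQ hR k).map isJetDerivation_totalD) (hT.mul (.coord k)),
    (isJetDerivation_pU i).mul hT (.coord k)]

theorem pU_pU_prolong_succ (hQ : Smooth₂ Q) (hR : Smooth₂ R) (j i k : ℕ) :
    pU j (pU i (prolong Q R (k + 1))) = pU j (pU i (totalD (prolong Q R k))) -
      (pU j (pU i (totalD (base Q))) * coord k + pU i (totalD (base Q)) * pU j (coord k) +
        pU j (totalD (base Q)) * pU i (coord k)) := by
  have hT := (IsJetPoly.base hQ).map isJetDerivation_totalD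
  have hTi := hT.map (isJetDerivation_pU i)
  have hk := (IsJetPoly.coord k).map (isJetDerivation_pU i)
  have hj := isJetDerivation_pU j
  rw [pU_prolong_succ hQ hR, hj.map_sub
    (((isJetPoly_prolong hQ hR k).map isJetDerivation_totalD).map (isJetDerivation_pU i))
    ((hTi.mul (.coord k)).add (hT.mul hk)),
    hj.add (hTi.mul (.coord k)) (hT.mul hk), hj.mul hTi (.coord k), hj.mul hT hk, pU_pU_coord,
    mul_zero, add_zero]

/-- The prolongation coefficient of order `k` involves only the first `k` jet variables. -/
theorem pU_prolong_of_le (hQ : Smooth₂ Q) (hR : Smooth₂ R) {i k : ℕ} (h : k ≤ i) :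
    pU i (prolong Q R k) = 0 := by
  induction k generalizing i with
  | zero => exact pU_base i R
  | succ k ih =>
    obtain ⟨i, rfl⟩ : ∃ j, i = j + 1 := ⟨i - 1, by omega⟩
    rw [pU_prolong_succ hQ hR, (isJetPoly_prolong hQ hR k).pU_succ_totalD, ih (by omega),
      ih (by omega), pU_succ_totalD_base hQ, pU_coord, if_neg (by omega), totalD_zero]
    simp

theorem atZero_pU_zero_prolong_succ (hQ : Smooth₂ Q) (hR : Smooth₂ R) (k : ℕ) :
    atZero (pU 0 (prolong Q R (k + 1))) = px (atZero (pU 0 (prolong Q R k))) +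
      pu (atZero (prolong Q R k)) - px Q * (if 0 = k then 1 else 0) := by
  rw [pU_prolong_succ hQ hR, (isJetPoly_prolong hQ hR k).pU_zero_totalD]
  simp only [atZero_sub, atZero_add, atZero_mul, atZero_totalD, atZero_du, atZero_base,
    atZero_coord, atZero_pU_coord, mul_zero, zero_add]

theorem atZero_pU_succ_prolong_succ (hQ : Smooth₂ Q) (hR : Smooth₂ R) (i k : ℕ) :
    atZero (pU (i + 1) (prolong Q R (k + 1))) = px (atZero (pU (i + 1) (prolong Q R k))) +
      atZero (pU i (prolong Q R k)) - px Q * (if i + 1 = k then 1 else 0) := by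
  rw [pU_prolong_succ hQ hR, (isJetPoly_prolong hQ hR k).pU_succ_totalD]
  simp only [atZero_sub, atZero_add, atZero_mul, atZero_totalD, atZero_base,
    atZero_coord, atZero_pU_coord, mul_zero, zero_add]

theorem atZero_pU_zero_pU_zero_prolong_succ (hQ : Smooth₂ Q) (hR : Smooth₂ R) (k : ℕ) :
    atZero (pU 0 (pU 0 (prolong Q R (k + 1)))) =
      px (atZero (pU 0 (pU 0 (prolong Q R k)))) + 2 * pu (atZero (pU 0 (prolong Q R k))) -
        2 * (pu Q * (if 0 = k then 1 else 0)) := by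
  have hP := isJetPoly_prolong hQ hR k
  have hP₀ := hP.map (isJetDerivation_pU 0)
  rw [pU_pU_prolong_succ hQ hR, hP.pU_zero_totalD, (isJetDerivation_pU 0).add
    (hP₀.map isJetDerivation_totalD) (hP.map isJetDerivation_du), hP₀.pU_zero_totalD, hP.pU_du,
    pU_zero_totalD_base hQ, pU_base]
  simp only [atZero_sub, atZero_add, atZero_mul, atZero_totalD, atZero_du, atZero_base,
    atZero_coord, atZero_pU_coord, mul_zero, zero_add]
  ring

theorem atZero_pU_one_pU_zero_prolong_succ (hQ : Smooth₂ Q) (hR : Smooth₂ R) (k : ℕ) :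
    atZero (pU 1 (pU 0 (prolong Q R (k + 1)))) =
      px (atZero (pU 1 (pU 0 (prolong Q R k)))) + atZero (pU 0 (pU 0 (prolong Q R k))) +
        pu (atZero (pU 1 (prolong Q R k))) - pu Q * (if 1 = k then 1 else 0) := by
  have hP := isJetPoly_prolong hQ hR k
  have hP₀ := hP.map (isJetDerivation_pU 0)
  rw [pU_pU_prolong_succ hQ hR, hP.pU_zero_totalD, (isJetDerivation_pU 1).add
    (hP₀.map isJetDerivation_totalD) (hP.map isJetDerivation_du), hP₀.pU_succ_totalD 0, hP.pU_du,
    pU_zero_totalD_base hQ, pU_succ_totalD_base hQ 0, pU_base]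
  simp only [atZero_sub, atZero_add, atZero_mul, atZero_totalD, atZero_du, atZero_base,
    atZero_pU_coord, zero_mul, zero_add, add_zero]

theorem atZero_pU_zero_pU_succ_prolong_succ (hQ : Smooth₂ Q) (hR : Smooth₂ R) (i k : ℕ) :
    atZero (pU 0 (pU (i + 1) (prolong Q R (k + 1)))) =
      px (atZero (pU 0 (pU (i + 1) (prolong Q R k)))) + pu (atZero (pU (i + 1) (prolong Q R k))) +
        atZero (pU 0 (pU i (prolong Q R k))) - pu Q * (if i + 1 = k then 1 else 0) := by
  have hP := isJetPoly_prolong hQ hR k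
  have hPi := hP.map (isJetDerivation_pU (i + 1))
  rw [pU_pU_prolong_succ hQ hR, hP.pU_succ_totalD, (isJetDerivation_pU 0).add
    (hPi.map isJetDerivation_totalD) (hP.map (isJetDerivation_pU i)), hPi.pU_zero_totalD,
    pU_zero_totalD_base hQ, pU_succ_totalD_base hQ]
  simp only [atZero_sub, atZero_add, atZero_mul, atZero_totalD, atZero_du, atZero_base,
    atZero_coord, atZero_pU_coord, atZero_zero, mul_zero, zero_mul, zero_add]

theorem atZero_pU_one_pU_succ_prolong_succ (hQ : Smooth₂ Q) (hR : Smooth₂ R) (i k : ℕ) :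
    atZero (pU 1 (pU (i + 1) (prolong Q R (k + 1)))) =
      px (atZero (pU 1 (pU (i + 1) (prolong Q R k)))) +
        atZero (pU 0 (pU (i + 1) (prolong Q R k))) + atZero (pU 1 (pU i (prolong Q R k))) := by
  have hP := isJetPoly_prolong hQ hR k
  have hPi := hP.map (isJetDerivation_pU (i + 1))
  rw [pU_pU_prolong_succ hQ hR, hP.pU_succ_totalD, (isJetDerivation_pU 1).add
    (hPi.map isJetDerivation_totalD) (hP.map (isJetDerivation_pU i)), hPi.pU_succ_totalD 0,
    pU_succ_totalD_base hQ 0, pU_succ_totalD_base hQ]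
  simp only [atZero_sub, atZero_add, atZero_mul, atZero_totalD,
    atZero_coord, mul_zero, zero_mul, add_zero, sub_zero]

/-- The coefficient of the constant monomial. -/
theorem atZero_prolong (Q R : ℝ → ℝ → ℝ) (k : ℕ) : atZero (prolong Q R k) = px^[k] R := by
  induction k with
  | zero => rfl
  | succ k ih =>
    rw [prolong_succ, atZero_sub, atZero_mul, atZero_totalD, atZero_coord, ih, mul_zero, sub_zero,
      Function.iterate_succ_apply']

theorem atZero_pU_pU_prolong_of_le (hQ : Smooth₂ Q) (hR : Smooth₂ R) (j : ℕ) {i k : ℕ}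
    (h : k ≤ i) : atZero (pU j (pU i (prolong Q R k))) = 0 := by
  rw [pU_prolong_of_le hQ hR h]
  funext x u
  simp [atZero, pU]

/-- The coefficient of the first jet variable. -/
theorem atZero_pU_zero_prolong (hQ : Smooth₂ Q) (hR : Smooth₂ R) (k : ℕ) :
    atZero (pU 0 (prolong Q R (k + 1))) =
      fun x u => ((k : ℝ) + 1) * pu (px^[k] R) x u - 1 * (px^[k + 1] Q) x u := by
  induction k with
  | zero =>
    rw [atZero_pU_zero_prolong_succ hQ hR, pU_prolong_of_le hQ hR le_rfl, atZero_zero, px_zero,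
      atZero_prolong]
    funext x u
    simp
  | succ k ih =>
    rw [atZero_pU_zero_prolong_succ hQ hR, ih, atZero_prolong,
      (hR.iterate_px k).pu.px_linear (hQ.iterate_px (k + 1)), (hR.iterate_px k).px_pu,
      ← Function.iterate_succ_apply' px, ← Function.iterate_succ_apply' px]
    funext x u
    simp
    ring

/-- The coefficient of the top jet variable. -/
theorem atZero_pU_top_prolong (hQ : Smooth₂ Q) (hR : Smooth₂ R) (k : ℕ) :
    atZero (pU k (prolong Q R (k + 1))) =
      fun x u => 1 * pu R x u - ((k : ℝ) + 1) * px Q x u := by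
  induction k with
  | zero => simpa using atZero_pU_zero_prolong hQ hR 0
  | succ k ih =>
    rw [atZero_pU_succ_prolong_succ hQ hR, ih, pU_prolong_of_le hQ hR le_rfl, atZero_zero, px_zero]
    funext x u
    simp
    ring

/-- The coefficient of the jet variable just below the top one. -/
theorem atZero_pU_subtop_prolong (hQ : Smooth₂ Q) (hR : Smooth₂ R) (k : ℕ) :
    atZero (pU k (prolong Q R (k + 2))) =
      fun x u => ((k : ℝ) + 2) * pu (px R) x u - ((k + 2).choose 2 : ℝ) * px (px Q) x u := by
  induction k with
  | zero =>
    rw [atZero_pU_zero_prolong hQ hR 1]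
    funext x u
    norm_num
  | succ k ih =>
    rw [atZero_pU_succ_prolong_succ hQ hR, ih, atZero_pU_top_prolong hQ hR (k + 1),
      hR.pu.px_linear hQ.px, hR.px_pu]
    funext x u
    simp [Nat.choose_succ_succ' (k + 2) 1]
    ring

/-- The coefficient of the product of the first and the top jet variables
(twice the coefficient of the square if the two coincide). -/
theorem atZero_pU_zero_pU_top_prolong (hQ : Smooth₂ Q) (hR : Smooth₂ R) (k : ℕ) :
    atZero (pU 0 (pU k (prolong Q R (k + 1)))) =
      fun x u => 0 * pu Q x u - ((k : ℝ) + 2) * pu Q x u := by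
  induction k with
  | zero =>
    rw [atZero_pU_zero_pU_zero_prolong_succ hQ hR, atZero_pU_pU_prolong_of_le hQ hR 0 le_rfl,
      pU_prolong_of_le hQ hR le_rfl, atZero_zero, px_zero, pu_zero]
    funext x u
    simp
  | succ k ih =>
    rw [atZero_pU_zero_pU_succ_prolong_succ hQ hR, atZero_pU_pU_prolong_of_le hQ hR 0 le_rfl,
      pU_prolong_of_le hQ hR le_rfl, atZero_zero, px_zero, pu_zero, ih]
    funext x u
    simp
    ring

/-- The coefficient of the product of the first jet variable and the one just below the top
(twice the coefficient of the square if the two coincide). -/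
theorem atZero_pU_zero_pU_subtop_prolong (hQ : Smooth₂ Q) (hR : Smooth₂ R) (k : ℕ) :
    atZero (pU 0 (pU k (prolong Q R (k + 2)))) =
      fun x u => ((k : ℝ) + 2) * pu (pu R) x u - ((k : ℝ) + 2) ^ 2 * pu (px Q) x u := by
  induction k with
  | zero =>
    rw [atZero_pU_zero_pU_zero_prolong_succ hQ hR, atZero_pU_zero_pU_top_prolong hQ hR 0,
      atZero_pU_top_prolong hQ hR 0, hR.pu.pu_linear hQ.px, hQ.pu.px_linear hQ.pu, hQ.px_pu]
    funext x u
    simp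
    ring
  | succ k ih =>
    rw [atZero_pU_zero_pU_succ_prolong_succ hQ hR, atZero_pU_zero_pU_top_prolong hQ hR (k + 1),
      atZero_pU_top_prolong hQ hR (k + 1), hR.pu.pu_linear hQ.px, hQ.pu.px_linear hQ.pu, hQ.px_pu,
      ih]
    funext x u
    simp
    ring

theorem atZero_pU_one_pU_top_prolong (hQ : Smooth₂ Q) (hR : Smooth₂ R) (k : ℕ) :
    atZero (pU 1 (pU k (prolong Q R (k + 1)))) = 0 := by
  induction k with
  | zero =>
    rw [atZero_pU_one_pU_zero_prolong_succ hQ hR, atZero_pU_pU_prolong_of_le hQ hR 0 le_rfl,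
      atZero_pU_pU_prolong_of_le hQ hR 1 le_rfl, pU_prolong_of_le hQ hR (Nat.zero_le 1),
      atZero_zero, px_zero, pu_zero]
    simp
  | succ k ih =>
    rw [atZero_pU_one_pU_succ_prolong_succ hQ hR, atZero_pU_pU_prolong_of_le hQ hR 0 le_rfl,
      atZero_pU_pU_prolong_of_le hQ hR 1 le_rfl, ih, px_zero, add_zero, add_zero]

/-- The coefficient of the product of the second jet variable and the one just below the top
(twice the coefficient of the square if the two coincide). -/
theorem atZero_pU_one_pU_subtop_prolong (hQ : Smooth₂ Q) (hR : Smooth₂ R) (k : ℕ) :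
    atZero (pU 1 (pU k (prolong Q R (k + 2)))) =
      fun x u => -((k + 3).choose 2 : ℝ) * pu Q x u := by
  induction k with
  | zero =>
    rw [atZero_pU_one_pU_zero_prolong_succ hQ hR, atZero_pU_one_pU_top_prolong hQ hR 0,
      atZero_pU_zero_pU_top_prolong hQ hR 0, pU_prolong_of_le hQ hR le_rfl, atZero_zero, px_zero,
      pu_zero]
    funext x u
    norm_num [Nat.choose]
    ring
  | succ k ih =>
    rw [atZero_pU_one_pU_succ_prolong_succ hQ hR, atZero_pU_one_pU_top_prolong hQ hR (k + 1),
      atZero_pU_zero_pU_top_prolong hQ hR (k + 1), px_zero, ih]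
    funext x u
    simp [Nat.choose_succ_succ' (k + 3) 1]
    ring

end Prolong

/-- Lemma 3.1: for κ ≥ 4, the coefficients of `R^κ`, as a polynomial in
the jet variables, of the monomials `1, U¹, U^{κ-1}, U¹U^{κ-1}, U²U^{κ-1}, U^κ, U¹U^κ`
are as in formula (e210).  Since all these monomials are squarefree, the coefficient of a
monomial `∏ U^{i}` is the corresponding mixed partial derivative of `R^κ` in the jet
variables evaluated at `U = 0`. -/
theorem stmt8 (κ : ℕ) (hκ : 4 ≤ κ) (Q R : ℝ → ℝ → ℝ)
    (hQ : ContDiff ℝ (⊤ : ℕ∞) (fun p : ℝ × ℝ => Q p.1 p.2))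
    (hR : ContDiff ℝ (⊤ : ℕ∞) (fun p : ℝ × ℝ => R p.1 p.2)) :
    ∀ x u : ℝ,
      prolong Q R κ x u (fun _ => 0) = (px^[κ] R) x u ∧
      pU 0 (prolong Q R κ) x u (fun _ => 0)
        = (κ.choose 1 : ℝ) * pu (px^[κ - 1] R) x u - (px^[κ] Q) x u ∧
      pU (κ - 2) (prolong Q R κ) x u (fun _ => 0)
        = (κ.choose 1 : ℝ) * pu (px R) x u - (κ.choose 2 : ℝ) * px (px Q) x u ∧
      pU 0 (pU (κ - 2) (prolong Q R κ)) x u (fun _ => 0)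
        = (κ.choose 1 : ℝ) * pu (pu R) x u - (κ : ℝ) ^ 2 * pu (px Q) x u ∧
      pU 1 (pU (κ - 2) (prolong Q R κ)) x u (fun _ => 0)
        = -((κ + 1).choose 2 : ℝ) * pu Q x u ∧
      pU (κ - 1) (prolong Q R κ) x u (fun _ => 0)
        = pu R x u - (κ.choose 1 : ℝ) * px Q x u ∧
      pU 0 (pU (κ - 1) (prolong Q R κ)) x u (fun _ => 0)
        = -((κ + 1).choose 1 : ℝ) * pu Q x u := by
  intro x u
  obtain ⟨k, rfl⟩ : ∃ k, κ = k + 2 := ⟨κ - 2, by omega⟩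
  have hQ' : Smooth₂ Q := hQ
  have hR' : Smooth₂ R := hR
  refine ⟨congrFun₂ (atZero_prolong Q R (k + 2)) x u,
    (congrFun₂ (atZero_pU_zero_prolong hQ' hR' (k + 1)) x u).trans ?_,
    (congrFun₂ (atZero_pU_subtop_prolong hQ' hR' k) x u).trans ?_,
    (congrFun₂ (atZero_pU_zero_pU_subtop_prolong hQ' hR' k) x u).trans ?_,
    congrFun₂ (atZero_pU_one_pU_subtop_prolong hQ' hR' k) x u,
    (congrFun₂ (atZero_pU_top_prolong hQ' hR' (k + 1)) x u).trans ?_,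
    (congrFun₂ (atZero_pU_zero_pU_top_prolong hQ' hR' (k + 1)) x u).trans ?_⟩
  all_goals
    simp only [Nat.choose_one_right, Nat.add_succ_sub_one]
    push_cast
    ring
end

section
/- If Q^l, R^j : ℝ^n × ℝ^m → ℝ (for l=1,…,n, j=1,…,m) are polynomial functions satisfying: all κ-th order pure-x derivatives of each R^j vanish, all first derivatives of each Q^l with respect to each u^{i} vanish, all second derivatives of each R^j with respect to pairs (u^{i₁}, u^{i₂}) vanish, all third order pure-x derivatives of each Q^l vanish, and the relations C(κ,1)R^j_{x_{k₁}u^{i₁}} = δ^j_{i₁}C(κ,2)Q^{k₁}_{x_{k₁}x_{k₁}}, R^j_{x_{k₁}u^{i₁}} = δ^j_{i₁}C(κ-1,1)Q^{k₂}_{x_{k₁}x_{k₂}} for k₂ ≠ k₁, and δ^j_{i₁}Q^{k₃}_{x_{k₁}x_{k₂}} = 0 for k₃ ∉ {k₁,k₂}, together with R^j_{x_{k₁}x_{k₂}u^{i₁}} = 0 — then there exist constants A^l, B^l_{k}, C_{k}, D^j_{i}, and E^j_β (for multi-indices β with |β| ≤ κ-1) such that Q^l(x,u) = A^l + Σ_k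 B^l_k x_k + Σ_k C_k x_k x_l and R^j(x,u) = (κ-1)Σ_k C_k x_k u^j + Σ_i D^j_i u^i + Σ_{|β|≤κ-1} E^j_β x^β. -/
open MvPolynomial

/-- iterated pure-`x` partial derivative along a list of indices. -/
noncomputable def iterDx {n m : ℕ} (ks : List (Fin n))
    (p : MvPolynomial (Fin n ⊕ Fin m) ℝ) : MvPolynomial (Fin n ⊕ Fin m) ℝ :=
  ks.foldr (fun k q => pderiv (Sum.inl k) q) p

/-- Partial derivatives of polynomials commute. -/
theorem pderiv_pderiv_comm {σ A : Type*} [CommSemiring A] (a b : σ) (p : MvPolynomial σ A) :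
    pderiv a (pderiv b p) = pderiv b (pderiv a p) := by
  classical
  ext s
  simp only [coeff_pderiv, add_right_comm s (Finsupp.single a 1), Finsupp.add_apply]
  rcases eq_or_ne a b with rfl | hab
  · rfl
  · simp only [Finsupp.single_eq_of_ne hab, Finsupp.single_eq_of_ne hab.symm]
    push_cast
    ring

/-- If `∂p/∂Xᵢ = 0`, then no monomial of `p` involves `Xᵢ`. -/
theorem coeff_eq_zero_of_pderiv_eq_zero {σ : Type*} {p : MvPolynomial σ ℝ} {i : σ}
    (h : pderiv i p = 0) {s : σ →₀ ℕ} (hs : s i ≠ 0) : coeff s p = 0 := by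
  have hle : Finsupp.single i 1 ≤ s := by
    simpa [Finsupp.single_le_iff, Nat.one_le_iff_ne_zero] using hs
  have hc := congrArg (coeff (s - Finsupp.single i 1)) h
  rw [coeff_pderiv, tsub_add_cancel_of_le hle, coeff_zero] at hc
  exact (mul_eq_zero.mp hc).resolve_right (by positivity)

/-- A polynomial all of whose partial derivatives vanish is constant. -/
theorem exists_eq_C_of_pderiv_eq_zero {σ : Type*} {p : MvPolynomial σ ℝ}
    (h : ∀ i, pderiv i p = 0) : ∃ c : ℝ, p = C c := by
  classical
  refine ⟨coeff 0 p, ?_⟩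
  ext s
  rw [coeff_C]
  split_ifs with hs
  · rw [hs]
  · obtain ⟨i, hi⟩ := Finsupp.ne_iff.mp (Ne.symm hs)
    exact coeff_eq_zero_of_pderiv_eq_zero (h i) hi

/-- A polynomial in `(x, u)` whose `u`-derivatives vanish is a polynomial in `x`. -/
theorem exists_rename_inl_eq_of_pderiv_inr_eq_zero {σ τ : Type*} {p : MvPolynomial (σ ⊕ τ) ℝ}
    (h : ∀ i, pderiv (Sum.inr i) p = 0) :
    ∃ q : MvPolynomial σ ℝ, rename Sum.inl q = p := by
  refine exists_rename_eq_of_vars_subset_range p Sum.inl Sum.inl_injective ?_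
  rintro (k | i) hv
  · exact ⟨k, rfl⟩
  · obtain ⟨s, hs, hi⟩ := (mem_vars_iff_mem_support _).mp hv
    exact absurd (coeff_eq_zero_of_pderiv_eq_zero (h i) (Finsupp.mem_support_iff.mp hi))
      (mem_support_iff.mp hs)

/-- If all pure-`x` derivatives of order `d` vanish, so do the coefficients of all pure-`x`
monomials of degree at least `d`. -/
theorem coeff_mapDomain_inl_eq_zero_of_iterDx_eq_zero {n m : ℕ} (d : ℕ)
    (p : MvPolynomial (Fin n ⊕ Fin m) ℝ)
    (h : ∀ ks : List (Fin n), ks.length = d → iterDx ks p = 0)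
    (s : Fin n →₀ ℕ) (hs : d ≤ s.degree) : coeff (s.mapDomain Sum.inl) p = 0 := by
  induction d generalizing p s with
  | zero =>
    have hp : p = 0 := h [] rfl
    rw [hp, coeff_zero]
  | succ d ih =>
    have hs0 : s ≠ 0 := by
      rintro rfl
      simp at hs
    obtain ⟨k, hk⟩ := Finsupp.ne_iff.mp hs0
    have hle : Finsupp.single k 1 ≤ s := by
      simpa [Finsupp.single_le_iff, Nat.one_le_iff_ne_zero] using hk
    obtain ⟨t, rfl⟩ := exists_add_of_le hle
    have ht : d ≤ t.degree := by
      rw [map_add, Finsupp.degree_single] at hs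
      omega
    have hc := ih (pderiv (Sum.inl k) p)
      (fun ks hks => by simpa [iterDx] using h (ks ++ [k]) (by simp [hks])) t ht
    rw [coeff_pderiv] at hc
    rw [Finsupp.mapDomain_add, Finsupp.mapDomain_single, add_comm]
    exact (mul_eq_zero.mp hc).resolve_right (by positivity)

/-- Derivative of a linear form in a subfamily of the variables. -/
theorem pderiv_sum_C_mul_X {ι σ : Type*} [Fintype ι] {f : ι → σ} (hf : Function.Injective f)
    (c : ι → ℝ) (k : ι) : pderiv (f k) (∑ i, C (c i) * X (f i)) = C (c k) := by
  classical
  rw [map_sum, Finset.sum_eq_single k]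
  · simp
  · intro i _ hi
    rw [pderiv_C_mul, pderiv_X_of_ne (hf.ne hi), mul_zero]
  · simp

/-- A linear form has zero derivative in any variable it does not involve. -/
theorem pderiv_sum_C_mul_X_of_ne {ι σ : Type*} [Fintype ι] {f : ι → σ} (c : ι → ℝ) {v : σ}
    (hv : ∀ i, f i ≠ v) : pderiv v (∑ i, C (c i) * X (f i)) = 0 := by
  rw [map_sum]
  exact Finset.sum_eq_zero fun i _ => by rw [pderiv_C_mul, pderiv_X_of_ne (hv i), mul_zero]

/-- A pure-`x` monomial does not occur in a multiple of some `u`-variable. -/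
theorem coeff_mapDomain_inl_mul_X_inr {σ τ : Type*} (s : σ →₀ ℕ) (i : τ)
    (p : MvPolynomial (σ ⊕ τ) ℝ) : coeff (s.mapDomain Sum.inl) (p * X (Sum.inr i)) = 0 := by
  classical
  rw [coeff_mul_X', if_neg]
  rw [Finsupp.mem_support_iff, not_not]
  exact Finsupp.mapDomain_of_notMem_range _ _ (by simp)

/-- A polynomial of `x` with second derivatives those of `(∑ cₖ xₖ) x_l` differs from it by an
affine function of `x`. -/
theorem exists_affine_of_pderiv_pderiv {n m : ℕ} (c : Fin n → ℝ) (l : Fin n)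
    (q : MvPolynomial (Fin n ⊕ Fin m) ℝ) (hu : ∀ i, pderiv (Sum.inr i) q = 0)
    (hxx : ∀ a b, pderiv (Sum.inl a) (pderiv (Sum.inl b) q) =
      C ((if a = l then c b else 0) + (if b = l then c a else 0))) :
    ∃ (A : ℝ) (B : Fin n → ℝ), q = C A + ∑ k, C (B k) * X (Sum.inl k)
      + ∑ k, C (c k) * X (Sum.inl k) * X (Sum.inl l) := by
  classical
  rw [← Finset.sum_mul]
  set L : MvPolynomial (Fin n ⊕ Fin m) ℝ := ∑ k, C (c k) * X (Sum.inl k)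
  have hLx : ∀ k, pderiv (Sum.inl k) L = C (c k) := pderiv_sum_C_mul_X Sum.inl_injective c
  have hLu : ∀ i, pderiv (Sum.inr i) L = 0 :=
    fun i => pderiv_sum_C_mul_X_of_ne c (by simp)
  have hru : ∀ i, pderiv (Sum.inr i) (q - L * X (Sum.inl l)) = 0 := fun i => by
    rw [map_sub, pderiv_mul, hu, hLu, pderiv_X_of_ne (by simp)]
    simp
  have hB : ∀ b, ∃ B : ℝ, pderiv (Sum.inl b) (q - L * X (Sum.inl l)) = C B := fun b => by
    refine exists_eq_C_of_pderiv_eq_zero ?_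
    rintro (a | i)
    · rw [map_sub, map_sub, hxx, pderiv_mul, (pderiv _).map_add, pderiv_mul, pderiv_mul, hLx, hLx]
      simp only [pderiv_X, Pi.single_apply, Sum.inl.injEq, pderiv_C]
      simp only [eq_comm (a := l)]
      split_ifs <;> simp
    · rw [pderiv_pderiv_comm, hru, map_zero]
  choose B hB using hB
  obtain ⟨A, hA⟩ : ∃ A : ℝ, q - L * X (Sum.inl l) - ∑ k, C (B k) * X (Sum.inl k) = C A := by
    refine exists_eq_C_of_pderiv_eq_zero ?_
    rintro (a | i)
    · rw [map_sub, hB, pderiv_sum_C_mul_X Sum.inl_injective B, sub_self]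
    · rw [map_sub, hru, pderiv_sum_C_mul_X_of_ne B (by simp), sub_zero]
  exact ⟨A, B, by rw [← hA]; ring⟩

/-- A polynomial affine in `u` whose mixed second derivatives are those of `(∑ cₖ xₖ) uʲ`
differs from it by a linear form in `u` plus a polynomial in `x`. -/
theorem exists_rename_of_pderiv_pderiv {n m : ℕ} (c : Fin n → ℝ) (j : Fin m)
    (r : MvPolynomial (Fin n ⊕ Fin m) ℝ)
    (huu : ∀ i₁ i₂, pderiv (Sum.inr i₁) (pderiv (Sum.inr i₂) r) = 0)
    (hux : ∀ i k, pderiv (Sum.inr i) (pderiv (Sum.inl k) r) = C (if j = i then c k else 0)) :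
    ∃ (D : Fin m → ℝ) (P : MvPolynomial (Fin n) ℝ),
      r = (∑ k, C (c k) * X (Sum.inl k)) * X (Sum.inr j)
        + ∑ i, C (D i) * X (Sum.inr i) + rename Sum.inl P := by
  classical
  set L : MvPolynomial (Fin n ⊕ Fin m) ℝ := ∑ k, C (c k) * X (Sum.inl k)
  have hLx : ∀ k, pderiv (Sum.inl k) L = C (c k) := pderiv_sum_C_mul_X Sum.inl_injective c
  have hLu : ∀ i, pderiv (Sum.inr i) L = 0 :=
    fun i => pderiv_sum_C_mul_X_of_ne c (by simp)
  have hD : ∀ i, ∃ D : ℝ, pderiv (Sum.inr i) (r - L * X (Sum.inr j)) = C D := fun i => by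
    refine exists_eq_C_of_pderiv_eq_zero ?_
    rintro (k | i')
    · rw [map_sub, map_sub, pderiv_pderiv_comm, hux, pderiv_mul, hLu]
      simp only [pderiv_X, Pi.single_apply, Sum.inr.injEq, zero_mul, zero_add]
      split_ifs <;> simp [hLx]
    · rw [map_sub, map_sub, huu, pderiv_mul, hLu]
      simp only [pderiv_X, Pi.single_apply, Sum.inr.injEq, zero_mul, zero_add]
      split_ifs <;> simp [hLu]
  choose D hD using hD
  obtain ⟨P, hP⟩ := exists_rename_inl_eq_of_pderiv_inr_eq_zero
    (p := r - L * X (Sum.inr j) - ∑ i, C (D i) * X (Sum.inr i)) fun i => by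
      rw [map_sub, hD, pderiv_sum_C_mul_X Sum.inr_injective D, sub_self]
  exact ⟨D, P, by rw [hP]; ring⟩

/-- determination (e47) of the general solution of the defining equations
(ee22), (ee27), (ee28) for the infinitesimal symmetries of `u^j_{x_{k₁}⋯x_{k_κ}} = 0`.
`Q l` and `R j` are polynomial functions of `(x, u)`, with `x_k = X (inl k)`,
`u^i = X (inr i)`. -/
theorem stmt9 (n m κ : ℕ) (hn : 1 ≤ n) (hm : 1 ≤ m) (hκ : 3 ≤ κ)
    (Q : Fin n → MvPolynomial (Fin n ⊕ Fin m) ℝ)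
    (R : Fin m → MvPolynomial (Fin n ⊕ Fin m) ℝ)
    -- all κ-th order pure-x derivatives of each R^j vanish
    (h1 : ∀ (j : Fin m) (ks : Fin κ → Fin n), iterDx (List.ofFn ks) (R j) = 0)
    -- all first derivatives of each Q^l with respect to each u^i vanish
    (h2 : ∀ (l : Fin n) (i : Fin m), pderiv (Sum.inr i) (Q l) = 0)
    -- all second derivatives of each R^j in (u^{i₁}, u^{i₂}) vanish
    (h3 : ∀ (j : Fin m) (i₁ i₂ : Fin m),
      pderiv (Sum.inr i₁) (pderiv (Sum.inr i₂) (R j)) = 0)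
    -- all third order pure-x derivatives of each Q^l vanish
    (h4 : ∀ (l : Fin n) (k₁ k₂ k₃ : Fin n),
      pderiv (Sum.inl k₁) (pderiv (Sum.inl k₂) (pderiv (Sum.inl k₃) (Q l))) = 0)
    -- C(κ,1) R^j_{x_{k₁}u^{i₁}} = δ^j_{i₁} C(κ,2) Q^{k₁}_{x_{k₁}x_{k₁}}
    (h5 : ∀ (j i₁ : Fin m) (k₁ : Fin n),
      C ((κ.choose 1 : ℕ) : ℝ) * pderiv (Sum.inr i₁) (pderiv (Sum.inl k₁) (R j))
        = C (if (j : Fin m) = i₁ then ((κ.choose 2 : ℕ) : ℝ) else 0) *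
            pderiv (Sum.inl k₁) (pderiv (Sum.inl k₁) (Q k₁)))
    -- R^j_{x_{k₁}u^{i₁}} = δ^j_{i₁} C(κ-1,1) Q^{k₂}_{x_{k₁}x_{k₂}} for k₂ ≠ k₁
    (h6 : ∀ (j i₁ : Fin m) (k₁ k₂ : Fin n), k₂ ≠ k₁ →
      pderiv (Sum.inr i₁) (pderiv (Sum.inl k₁) (R j))
        = C (if (j : Fin m) = i₁ then (((κ - 1).choose 1 : ℕ) : ℝ) else 0) *
            pderiv (Sum.inl k₁) (pderiv (Sum.inl k₂) (Q k₂)))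
    -- δ^j_{i₁} Q^{k₃}_{x_{k₁}x_{k₂}} = 0 for k₃ ∉ {k₁, k₂}
    (h7 : ∀ (j i₁ : Fin m) (k₁ k₂ k₃ : Fin n), k₃ ≠ k₁ → k₃ ≠ k₂ →
      C (if (j : Fin m) = i₁ then (1 : ℝ) else 0) *
        pderiv (Sum.inl k₁) (pderiv (Sum.inl k₂) (Q k₃)) = 0)
    -- R^j_{x_{k₁}x_{k₂}u^{i₁}} = 0
    (h8 : ∀ (j i₁ : Fin m) (k₁ k₂ : Fin n),
      pderiv (Sum.inr i₁) (pderiv (Sum.inl k₁) (pderiv (Sum.inl k₂) (R j))) = 0) :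
    ∃ (A : Fin n → ℝ) (B : Fin n → Fin n → ℝ) (Cc : Fin n → ℝ)
      (D : Fin m → Fin m → ℝ) (P : Fin m → MvPolynomial (Fin n) ℝ),
      (∀ j, (P j).totalDegree ≤ κ - 1) ∧
      (∀ l, Q l = C (A l) + ∑ k, C (B l k) * X (Sum.inl k)
              + ∑ k, C (Cc k) * X (Sum.inl k) * X (Sum.inl l)) ∧
      (∀ j, R j = C ((κ : ℝ) - 1) * (∑ k, C (Cc k) * X (Sum.inl k)) * X (Sum.inr j)
              + ∑ i, C (D j i) * X (Sum.inr i)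
              + rename Sum.inl (P j)) := by
  classical
  have hκ0 : (κ : ℝ) ≠ 0 := by positivity
  have hκ1 : (κ : ℝ) - 1 ≠ 0 := by
    have : (3 : ℝ) ≤ κ := by exact_mod_cast hκ
    linarith
  have hchoose : (((κ - 1).choose 1 : ℕ) : ℝ) = κ - 1 := by
    rw [Nat.choose_one_right, Nat.cast_sub (by omega), Nat.cast_one]
  have hconst : ∀ k, ∃ c : ℝ, pderiv (Sum.inl k) (pderiv (Sum.inl k) (Q k)) = C c := fun k => by
    refine exists_eq_C_of_pderiv_eq_zero ?_
    rintro (a | i)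
    · exact h4 k a k k
    · rw [pderiv_pderiv_comm, pderiv_pderiv_comm (Sum.inr i), h2, map_zero, map_zero]
  choose e he using hconst
  set c : Fin n → ℝ := fun k => e k / 2 with hc
  have hRux : ∀ j i k, pderiv (Sum.inr i) (pderiv (Sum.inl k) (R j)) =
      C (if j = i then ((κ : ℝ) - 1) * c k else 0) := fun j i k => by
    have h := h5 j i k
    rw [he, ← C_mul, Nat.choose_one_right, Nat.cast_choose_two] at h
    refine mul_left_cancel₀ (C_ne_zero.mpr hκ0) (h.trans ?_)
    rw [← C_mul]
    congr 1
    split_ifs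
    · simp only [hc]
      ring
    · ring
  let j₀ : Fin m := ⟨0, hm⟩
  have hmixed : ∀ a b, b ≠ a → pderiv (Sum.inl a) (pderiv (Sum.inl b) (Q b)) = C (c a) :=
    fun a b hab => by
      have h := h6 j₀ j₀ a b hab
      rw [hRux, if_pos rfl, if_pos rfl, hchoose, C_mul] at h
      exact (mul_left_cancel₀ (C_ne_zero.mpr hκ1) h).symm
  have hQxx : ∀ l a b, pderiv (Sum.inl a) (pderiv (Sum.inl b) (Q l)) =
      C ((if a = l then c b else 0) + (if b = l then c a else 0)) := fun l a b => by
    by_cases ha : a = l <;> by_cases hb : b = l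
    · subst ha hb
      rw [he]
      simp [hc]
    · subst ha
      rw [pderiv_pderiv_comm, hmixed b a (Ne.symm hb)]
      simp [hb]
    · subst hb
      rw [hmixed a b (Ne.symm ha)]
      simp [ha]
    · simpa [ha, hb] using h7 j₀ j₀ a b l (Ne.symm ha) (Ne.symm hb)
  choose A B hQ using fun l => exists_affine_of_pderiv_pderiv c l (Q l) (h2 l) (hQxx l)
  choose D P hR using fun j =>
    exists_rename_of_pderiv_pderiv (fun k => ((κ : ℝ) - 1) * c k) j (R j) (h3 j) (hRux j)
  refine ⟨A, B, c, D, P, fun j => ?_, hQ, fun j => ?_⟩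
  · refine Finset.sup_le fun s hs => ?_
    by_contra! hlt
    refine mem_support_iff.mp hs ?_
    have hz := coeff_mapDomain_inl_eq_zero_of_iterDx_eq_zero κ (R j)
      (fun ks hks => by
        subst hks
        simpa using h1 j ks.get) s (by
        change κ - 1 < s.degree at hlt
        omega)
    rw [hR j, coeff_add, coeff_add, coeff_mapDomain_inl_mul_X_inr, coeff_sum,
      Finset.sum_eq_zero fun i _ => coeff_mapDomain_inl_mul_X_inr s i _,
      coeff_rename_mapDomain _ Sum.inl_injective] at hz
    simpa using hz
  · rw [Finset.mul_sum]
    simpa only [C_mul, mul_assoc] using hR j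
end
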